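/- Let α > 0 and let the family (μ^(k)) be in the mean Nevai class M^(C,α)(Σ_{la,lb}) for the Cesàro weights σ_{n,k}^(C,α), with limits Σ_{la,lb} = 0 for la ≥ 1 and Σ_{0,lb} = Γ(α/2+1) Γ(lb/2+1) / ( 2^{lb} Γ((α+lb)/2 + 1) ). Then for every bounded continuous function f : ℝ → ℝ, lim_{n→∞} Σ_{k=0}^n ( binom(n−k+α−1, n−k)/binom(n+α+1, n) ) ∫_ℝ f(x) K_k^(n−k)(x,x) dμ^(n−k)(x) = (1/m^(α/2)) ∫_{−1}^1 f(x)(1−x²)^{(α−1)/2} dx, and lim_{n→∞} Σ_{k=0}^n ( binom(n−k+α−1, n−k)/binom(n+α+1, n) ) Σ_{j=1}^{k+1} f(x_{k+1,j}^(n−k)) = (1/m^(α/2)) ∫_{−1}^1 f(x)(1−x²)^{(α−1)/2} dx, where binom(n−k+α−1, n−k)/binom(n+α+1, n) = Γ(n−k+α) Γ(α+2) Γ(n+1) / ( Γ(α) Γ(n−k+1) Γ(n+α+2) ), K is the Christoffel–Darboux kernel, x_{k+1,j}^(n−k) are the roots of p_{k+1}^(n−k), and m^(α/2) = ∫_{−1}^1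 (1−x²)^{(α−1)/2} dx. -/

import Mathlib

open Filter MeasureTheory

/-- The mixed moments `∫ x ^ d p i p j` of a sequence of polynomials. -/
noncomputable def mixedMoment (μ : Measure ℝ) (p : ℕ → Polynomial ℝ) (d i j : ℕ) : ℝ :=
  ∫ x, x ^ d * ((p i).eval x * (p j).eval x) ∂μ

lemma ae_mem_of_compl_null {μ : Measure ℝ} {R : ℝ} (hμ : μ ((Set.Icc (-R) R)ᶜ) = 0) :
    ∀ᵐ x ∂μ, x ∈ Set.Icc (-R) R := by
  rw [ae_iff]; exact hμ

lemma integrable_of_continuous {μ : Measure ℝ} [IsFiniteMeasure μ] {R : ℝ}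
    (hμ : μ ((Set.Icc (-R) R)ᶜ) = 0) {f : ℝ → ℝ} (hf : Continuous f) : Integrable f μ := by
  rw [← Measure.restrict_eq_self_of_ae_mem (ae_mem_of_compl_null hμ)]
  exact hf.continuousOn.integrableOn_compact isCompact_Icc

section Orthonormal

variable {μ : Measure ℝ} [IsFiniteMeasure μ] {R : ℝ} {p : ℕ → Polynomial ℝ} {a b : ℕ → ℝ}

lemma eval_recurrence
    (hrec : ∀ l, Polynomial.X * p l =
      Polynomial.C (b (l+1)) * p (l+1) + Polynomial.C (a l) * p l + Polynomial.C (b l) * p (l-1))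
    (l : ℕ) (x : ℝ) :
    x * (p l).eval x = b (l+1) * (p (l+1)).eval x + a l * (p l).eval x
      + b l * (p (l-1)).eval x := by
  simpa using congrArg (Polynomial.eval x) (hrec l)

lemma mixedMoment_succ (hμ : μ ((Set.Icc (-R) R)ᶜ) = 0)
    (hrec : ∀ l, Polynomial.X * p l =
      Polynomial.C (b (l+1)) * p (l+1) + Polynomial.C (a l) * p l + Polynomial.C (b l) * p (l-1))
    (d l j : ℕ) :
    mixedMoment μ p (d+1) l j = b (l+1) * mixedMoment μ p d (l+1) j + a l * mixedMoment μ p d l j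
      + b l * mixedMoment μ p d (l-1) j := by
  have hint : ∀ i, Integrable (fun x => x ^ d * ((p i).eval x * (p j).eval x)) μ := fun i =>
    integrable_of_continuous hμ (by fun_prop)
  unfold mixedMoment
  rw [← integral_const_mul, ← integral_const_mul, ← integral_const_mul,
    ← integral_add ((hint _).const_mul _) ((hint _).const_mul _),
    ← integral_add (integrable_of_continuous hμ (by fun_prop)) ((hint _).const_mul _)]
  congr 1
  ext x
  linear_combination x ^ d * (p j).eval x * eval_recurrence hrec l x

lemma integral_mul_sq_sub_le (hμ : μ ((Set.Icc (-R) R)ᶜ) = 0)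
    (horth : ∀ l m, (∫ x, (p l).eval x * (p m).eval x ∂μ) = if l = m then 1 else 0)
    {f g : ℝ → ℝ} (hf : Continuous f) (hg : Continuous g) {ε : ℝ}
    (hfg : ∀ x ∈ Set.Icc (-R) R, |f x - g x| ≤ ε) (l : ℕ) :
    |(∫ x, f x * (p l).eval x ^ 2 ∂μ) - ∫ x, g x * (p l).eval x ^ 2 ∂μ| ≤ ε := by
  rw [← integral_sub (integrable_of_continuous hμ (by fun_prop))
    (integrable_of_continuous hμ (by fun_prop)), ← Real.norm_eq_abs]
  refine (norm_integral_le_of_norm_le (g := fun x => ε * ((p l).eval x * (p l).eval x))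
    (integrable_of_continuous hμ (by fun_prop)) ?_).trans ?_
  · filter_upwards [ae_mem_of_compl_null hμ] with x hx
    rw [← sub_mul, norm_mul, Real.norm_eq_abs, Real.norm_eq_abs,
      abs_of_nonneg (sq_nonneg ((p l).eval x)), sq]
    exact mul_le_mul_of_nonneg_right (hfg x hx) (mul_self_nonneg _)
  · rw [integral_const_mul, horth]; simp

lemma abs_mixedMoment_le (hμ : μ ((Set.Icc (-R) R)ᶜ) = 0)
    (horth : ∀ l m, (∫ x, (p l).eval x * (p m).eval x ∂μ) = if l = m then 1 else 0)
    (d i j : ℕ) : |mixedMoment μ p d i j| ≤ R ^ d := by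
  unfold mixedMoment
  rw [← Real.norm_eq_abs]
  refine (norm_integral_le_of_norm_le
    (g := fun x => R ^ d / 2 * ((p i).eval x * (p i).eval x)
      + R ^ d / 2 * ((p j).eval x * (p j).eval x))
    (integrable_of_continuous hμ (by fun_prop)) ?_).trans ?_
  · filter_upwards [ae_mem_of_compl_null hμ] with x hx
    rw [norm_mul, norm_pow, Real.norm_eq_abs, Real.norm_eq_abs]
    have h1 : |x| ^ d ≤ R ^ d := pow_le_pow_left₀ (abs_nonneg _) (abs_le.2 hx) d
    have h2 : |(p i).eval x * (p j).eval x| ≤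
        ((p i).eval x * (p i).eval x + (p j).eval x * (p j).eval x) / 2 := by
      rw [abs_le]
      constructor <;> nlinarith [sq_nonneg ((p i).eval x + (p j).eval x),
        sq_nonneg ((p i).eval x - (p j).eval x)]
    calc |x| ^ d * |(p i).eval x * (p j).eval x|
        ≤ R ^ d * (((p i).eval x * (p i).eval x + (p j).eval x * (p j).eval x) / 2) :=
          mul_le_mul h1 h2 (abs_nonneg _) ((pow_nonneg (abs_nonneg _) _).trans h1)
      _ = _ := by ring
  · rw [integral_add (integrable_of_continuous hμ (by fun_prop))
      (integrable_of_continuous hμ (by fun_prop)), integral_const_mul, integral_const_mul,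
      horth, horth]
    simp

lemma christoffelDarboux
    (hrec : ∀ l, Polynomial.X * p l =
      Polynomial.C (b (l+1)) * p (l+1) + Polynomial.C (a l) * p l + Polynomial.C (b l) * p (l-1))
    (hb0 : b 0 = 0) (n : ℕ) (x y : ℝ) :
    (x - y) * ∑ l ∈ Finset.range (n+1), (p l).eval x * (p l).eval y =
      b (n+1) * ((p (n+1)).eval x * (p n).eval y - (p n).eval x * (p (n+1)).eval y) := by
  induction n with
  | zero =>
    have h1 := eval_recurrence hrec 0 x
    have h2 := eval_recurrence hrec 0 y
    simp only [hb0, Finset.sum_range_one, zero_add] at *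
    linear_combination (p 0).eval y * h1 - (p 0).eval x * h2
  | succ n ih =>
    have h1 := eval_recurrence hrec (n+1) x
    have h2 := eval_recurrence hrec (n+1) y
    rw [Finset.sum_range_succ, mul_add, ih]
    simp only [Nat.add_sub_cancel] at h1 h2
    linear_combination (p (n+1)).eval y * h1 - (p (n+1)).eval x * h2

lemma eval_zero_pos (hdeg : ∀ l, (p l).natDegree = l) (hlead : ∀ l, 0 < (p l).leadingCoeff)
    (x : ℝ) : 0 < (p 0).eval x := by
  have h := hlead 0
  rw [Polynomial.leadingCoeff, hdeg 0] at h
  rw [Polynomial.eq_C_of_natDegree_eq_zero (hdeg 0)]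
  simpa using h

lemma abs_root_le
    (hrec : ∀ l, Polynomial.X * p l =
      Polynomial.C (b (l+1)) * p (l+1) + Polynomial.C (a l) * p l + Polynomial.C (b l) * p (l-1))
    {x : ℝ} (h0 : 0 < (p 0).eval x) {A B : ℝ} (hA : ∀ l, |a l| ≤ A) (hB : ∀ l, |b l| ≤ B)
    {n : ℕ} (hx : (p (n+1)).eval x = 0) : |x| ≤ A + 2 * B := by
  obtain ⟨l, hl, hmax⟩ := Finset.exists_max_image (Finset.range (n+1))
    (fun l => |(p l).eval x|) ⟨0, by simp⟩
  have hpos : 0 < |(p l).eval x| := (abs_pos.2 h0.ne').trans_le (hmax 0 (by simp))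
  have hl' : l ≤ n := by simpa [Nat.lt_succ_iff] using hl
  have hup : |(p (l+1)).eval x| ≤ |(p l).eval x| := by
    rcases hl'.eq_or_lt with h | h
    · rw [h, hx]; simp
    · exact hmax _ (by simpa using h)
  have hdown : |(p (l-1)).eval x| ≤ |(p l).eval x| := hmax _ (by simp; omega)
  refine le_of_mul_le_mul_right ?_ hpos
  rw [← abs_mul, eval_recurrence hrec l x]
  calc _ ≤ |b (l+1) * (p (l+1)).eval x| + |a l * (p l).eval x| + |b l * (p (l-1)).eval x| :=
        abs_add_three _ _ _
    _ ≤ B * |(p l).eval x| + A * |(p l).eval x| + B * |(p l).eval x| := by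
        simp only [abs_mul]
        have hB0 : 0 ≤ B := (abs_nonneg _).trans (hB 0)
        gcongr <;> first | exact hB _ | exact hA _
    _ = _ := by ring

/-- The moments of the Gauss quadrature rule with nodes `y`. -/
noncomputable def gaussMoment (p : ℕ → Polynomial ℝ) (n : ℕ) (y : Fin (n+1) → ℝ) (d i j : ℕ) : ℝ :=
  ∑ s, (∑ l ∈ Finset.range (n+1), (p l).eval (y s) ^ 2)⁻¹ *
    (y s ^ d * ((p i).eval (y s) * (p j).eval (y s)))

lemma kernel_pos {x : ℝ} (h0 : 0 < (p 0).eval x) (n : ℕ) :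
    0 < ∑ l ∈ Finset.range (n+1), (p l).eval x ^ 2 :=
  Finset.sum_pos' (fun _ _ => sq_nonneg _) ⟨0, by simp, by positivity⟩

lemma gaussMoment_zero
    (hrec : ∀ l, Polynomial.X * p l =
      Polynomial.C (b (l+1)) * p (l+1) + Polynomial.C (a l) * p l + Polynomial.C (b l) * p (l-1))
    (hb0 : b 0 = 0) (h0 : ∀ x, 0 < (p 0).eval x) {n : ℕ} {y : Fin (n+1) → ℝ}
    (hy : Function.Injective y) (hroot : ∀ s, (p (n+1)).eval (y s) = 0)
    {i j : ℕ} (hi : i ≤ n) (hj : j ≤ n) :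
    gaussMoment p n y 0 i j = if i = j then 1 else 0 := by
  let V : Matrix (Fin (n+1)) (Fin (n+1)) ℝ := fun s l => (p l).eval (y s)
  let W : Matrix (Fin (n+1)) (Fin (n+1)) ℝ := fun l s =>
    (p l).eval (y s) * (∑ l ∈ Finset.range (n+1), (p l).eval (y s) ^ 2)⁻¹
  have hVW : V * W = 1 := by
    ext s t
    have hst : (V * W) s t = (∑ l ∈ Finset.range (n+1), (p l).eval (y s) * (p l).eval (y t)) *
        (∑ l ∈ Finset.range (n+1), (p l).eval (y t) ^ 2)⁻¹ := by
      rw [Matrix.mul_apply, ← Fin.sum_univ_eq_sum_range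
        (fun l => (p l).eval (y s) * (p l).eval (y t)), Finset.sum_mul]
      simp only [V, W, mul_assoc]
    rw [hst, Matrix.one_apply]
    split_ifs with h
    · subst h
      simp only [← sq]
      exact mul_inv_cancel₀ (kernel_pos (h0 _) n).ne'
    · have h1 := christoffelDarboux hrec hb0 n (y s) (y t)
      rw [hroot, hroot] at h1
      have h2 : y s - y t ≠ 0 := sub_ne_zero.2 fun e => h (hy e)
      rw [(mul_eq_zero.1 (h1.trans (by ring))).resolve_left h2, zero_mul]
  have hWV : W * V = 1 := mul_eq_one_comm.1 hVW
  have := congrFun (congrFun hWV ⟨i, by omega⟩) ⟨j, by omega⟩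
  rw [Matrix.mul_apply, Matrix.one_apply] at this
  simp only [Fin.mk.injEq] at this
  rw [← this]
  refine Finset.sum_congr rfl fun s _ => ?_
  simp only [V, W]
  ring

lemma gaussMoment_eq (hμ : μ ((Set.Icc (-R) R)ᶜ) = 0)
    (horth : ∀ l m, (∫ x, (p l).eval x * (p m).eval x ∂μ) = if l = m then 1 else 0)
    (hrec : ∀ l, Polynomial.X * p l =
      Polynomial.C (b (l+1)) * p (l+1) + Polynomial.C (a l) * p l + Polynomial.C (b l) * p (l-1))
    (hb0 : b 0 = 0) (h0 : ∀ x, 0 < (p 0).eval x) {n : ℕ} {y : Fin (n+1) → ℝ}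
    (hy : Function.Injective y) (hroot : ∀ s, (p (n+1)).eval (y s) = 0)
    {j : ℕ} (hj : j ≤ n) (d i : ℕ) (hi : i + d ≤ n) :
    gaussMoment p n y d i j = mixedMoment μ p d i j := by
  induction d generalizing i with
  | zero =>
    rw [gaussMoment_zero hrec hb0 h0 hy hroot (by omega) hj, ← horth i j]
    simp [mixedMoment]
  | succ d ih =>
    rw [mixedMoment_succ hμ hrec, ← ih (i+1) (by omega), ← ih i (by omega),
      ← ih (i-1) (by omega)]
    simp only [gaussMoment, Finset.mul_sum, ← Finset.sum_add_distrib]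
    refine Finset.sum_congr rfl fun s _ => ?_
    linear_combination (∑ l ∈ Finset.range (n+1), (p l).eval (y s) ^ 2)⁻¹ * y s ^ d *
      (p j).eval (y s) * eval_recurrence hrec i (y s)

lemma abs_gaussMoment_le
    (hrec : ∀ l, Polynomial.X * p l =
      Polynomial.C (b (l+1)) * p (l+1) + Polynomial.C (a l) * p l + Polynomial.C (b l) * p (l-1))
    (hb0 : b 0 = 0) (h0 : ∀ x, 0 < (p 0).eval x) {n : ℕ} {y : Fin (n+1) → ℝ}
    (hy : Function.Injective y) (hroot : ∀ s, (p (n+1)).eval (y s) = 0)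
    (hyR : ∀ s, |y s| ≤ R) (d : ℕ) {i : ℕ} (hi : i ≤ n) :
    |gaussMoment p n y d i i| ≤ R ^ d := by
  have h1 := gaussMoment_zero hrec hb0 h0 hy hroot hi hi
  rw [if_pos rfl] at h1
  rw [← mul_one (R ^ d), ← h1]
  unfold gaussMoment
  rw [Finset.mul_sum]
  refine (Finset.abs_sum_le_sum_abs _ _).trans (Finset.sum_le_sum fun s _ => ?_)
  have hK := (kernel_pos (h0 (y s)) n).le
  have hR : |y s| ^ d ≤ R ^ d := pow_le_pow_left₀ (abs_nonneg _) (hyR s) d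
  rw [abs_mul, abs_mul, abs_pow, abs_of_nonneg (inv_nonneg.2 hK),
    abs_of_nonneg (mul_self_nonneg ((p i).eval (y s)))]
  calc _ = |y s| ^ d * ((∑ l ∈ Finset.range (n+1), (p l).eval (y s) ^ 2)⁻¹ *
        ((p i).eval (y s) * (p i).eval (y s))) := by ring
    _ ≤ R ^ d * ((∑ l ∈ Finset.range (n+1), (p l).eval (y s) ^ 2)⁻¹ *
        ((p i).eval (y s) * (p i).eval (y s))) :=
      mul_le_mul_of_nonneg_right hR (mul_nonneg (inv_nonneg.2 hK) (mul_self_nonneg _))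
    _ = _ := by ring

lemma sum_gaussMoment (h0 : ∀ x, 0 < (p 0).eval x) {n : ℕ} (y : Fin (n+1) → ℝ) (d : ℕ) :
    ∑ l ∈ Finset.range (n+1), gaussMoment p n y d l l = ∑ s, y s ^ d := by
  unfold gaussMoment
  rw [Finset.sum_comm]
  refine Finset.sum_congr rfl fun s _ => ?_
  rw [← Finset.mul_sum, ← Finset.mul_sum]
  simp only [← sq]
  have := (kernel_pos (h0 (y s)) n).ne'
  field_simp

lemma abs_sum_sub_sum_le {u v : ℕ → ℝ} {C : ℝ} {d N : ℕ} (hu : ∀ l < N, |u l| ≤ C)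
    (hv : ∀ l < N, |v l| ≤ C) (huv : ∀ l, l + d < N → u l = v l) (hC : 0 ≤ C) :
    |∑ l ∈ Finset.range N, u l - ∑ l ∈ Finset.range N, v l| ≤ 2 * d * C := by
  have hle : ∀ l < N, |u l - v l| ≤ 2 * C := fun l hl =>
    (abs_sub _ _).trans (by linarith [hu l hl, hv l hl])
  rw [← Finset.sum_sub_distrib]
  rcases le_total N d with h | h
  · calc _ ≤ ∑ l ∈ Finset.range N, |u l - v l| := Finset.abs_sum_le_sum_abs _ _
      _ ≤ ∑ l ∈ Finset.range N, 2 * C :=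
        Finset.sum_le_sum fun l hl => hle l (Finset.mem_range.1 hl)
      _ = N * (2 * C) := by simp
      _ ≤ d * (2 * C) := by gcongr
      _ = _ := by ring
  · obtain ⟨M, rfl⟩ := Nat.exists_eq_add_of_le' h
    rw [Finset.sum_range_add, Finset.sum_eq_zero (s := Finset.range M), zero_add]
    · calc _ ≤ ∑ l ∈ Finset.range d, |u (M+l) - v (M+l)| := Finset.abs_sum_le_sum_abs _ _
        _ ≤ ∑ l ∈ Finset.range d, 2 * C :=
          Finset.sum_le_sum fun l hl => hle _ (by have := Finset.mem_range.1 hl; omega)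
        _ = _ := by simp; ring
    · intro l hl
      rw [huv l (by have := Finset.mem_range.1 hl; omega), sub_self]

lemma abs_sum_sub_sum_shift_le {u : ℕ → ℝ} {C : ℝ} (hu : ∀ l, |u l| ≤ C) (d N : ℕ) :
    |∑ l ∈ Finset.range N, u l - ∑ l ∈ Finset.range N, u (l+d)| ≤ 2 * d * C := by
  have h1 := Finset.sum_range_add u N d
  have h2 := Finset.sum_range_add u d N
  rw [add_comm d N] at h2
  have hb : ∀ v : ℕ → ℝ, (∀ l, |v l| ≤ C) → |∑ l ∈ Finset.range d, v l| ≤ d * C := fun v hv =>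
    (Finset.abs_sum_le_sum_abs _ _).trans ((Finset.sum_le_sum fun l _ => hv l).trans (by simp))
  have e : ∑ l ∈ Finset.range N, u l - ∑ l ∈ Finset.range N, u (l+d) =
      ∑ l ∈ Finset.range d, u l - ∑ l ∈ Finset.range d, u (N+l) := by
    simp only [add_comm _ d]; linarith
  rw [e]
  refine (abs_sub _ _).trans ?_
  linarith [hb u hu, hb (fun l => u (N+l)) fun l => hu _]

lemma abs_sum_roots_sub_le (hμ : μ ((Set.Icc (-R) R)ᶜ) = 0) (hR : 0 ≤ R)
    (horth : ∀ l m, (∫ x, (p l).eval x * (p m).eval x ∂μ) = if l = m then 1 else 0)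
    (hrec : ∀ l, Polynomial.X * p l =
      Polynomial.C (b (l+1)) * p (l+1) + Polynomial.C (a l) * p l + Polynomial.C (b l) * p (l-1))
    (hb0 : b 0 = 0) (h0 : ∀ x, 0 < (p 0).eval x) {n : ℕ} {y : Fin (n+1) → ℝ}
    (hy : Function.Injective y) (hroot : ∀ s, (p (n+1)).eval (y s) = 0)
    (hyR : ∀ s, |y s| ≤ R) (d : ℕ) :
    |∑ s, y s ^ d - ∑ l ∈ Finset.range (n+1), mixedMoment μ p d l l| ≤ 2 * d * R ^ d := by
  rw [← sum_gaussMoment h0]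
  refine abs_sum_sub_sum_le (fun l hl => ?_) (fun l _ => abs_mixedMoment_le hμ horth _ _ _)
    (fun l hl => ?_) (pow_nonneg hR d)
  · exact abs_gaussMoment_le hrec hb0 h0 hy hroot hyR d (by omega)
  · exact gaussMoment_eq hμ horth hrec hb0 h0 hy hroot (by omega) _ _ (by omega)

end Orthonormal

/-- The number of nearest-neighbour walks of length `d` on `ℤ` from `s` to `0`. -/
def walkCount : ℕ → ℤ → ℝ
  | 0, s => if s = 0 then 1 else 0
  | d + 1, s => walkCount d (s + 1) + walkCount d (s - 1)

lemma walkCount_of_lt (d : ℕ) {s : ℤ} (hs : d < s) : walkCount d s = 0 := by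
  induction d generalizing s with
  | zero => simp only [walkCount]; rw [if_neg]; push_cast at hs; omega
  | succ d ih =>
    push_cast at hs
    rw [walkCount, ih (by omega), ih (by omega), add_zero]

lemma walkCount_sub_two_mul (d t : ℕ) : walkCount d (d - 2 * t) = d.choose t := by
  induction d generalizing t with
  | zero =>
    cases t with
    | zero => simp [walkCount]
    | succ t => simp only [walkCount, Nat.choose_zero_succ]; rw [if_neg]; · simp
                push_cast; omega
  | succ d ih =>
    cases t with
    | zero =>
      have h := ih 0
      rw [walkCount, walkCount_of_lt d (by push_cast; omega)]
      simp only [Nat.choose_zero_right] at h ⊢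
      rw [← h, zero_add]
      congr 1
      push_cast
      ring
    | succ t =>
      rw [walkCount, Nat.choose_succ_succ', Nat.cast_add (d.choose t), ← ih t, ← ih (t+1)]
      congr 2 <;> · push_cast; ring

lemma walkCount_odd (d : ℕ) {s : ℤ} (hs : Odd (d + s)) : walkCount d s = 0 := by
  induction d generalizing s with
  | zero => simp only [walkCount]; rw [if_neg]; rintro rfl; simp at hs
  | succ d ih =>
    push_cast at hs
    rw [walkCount, ih, ih, add_zero] <;> rw [Int.odd_iff] at * <;> omega

lemma walkCount_add_two (d : ℕ) :
    (d + 2) * walkCount (d+2) 0 = 4 * (d + 1) * walkCount d 0 := by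
  rcases Nat.even_or_odd' d with ⟨i, rfl | rfl⟩
  · have h : ∀ i : ℕ, walkCount (2 * i) 0 = i.centralBinom := fun i => by
      rw [Nat.centralBinom, ← walkCount_sub_two_mul]; congr 1; push_cast; ring
    have hs : (((i:ℝ) + 1) * (i+1).centralBinom) = 2 * (2 * i + 1) * i.centralBinom := by
      exact_mod_cast Nat.succ_mul_centralBinom_succ i
    rw [show 2 * i + 2 = 2 * (i+1) by ring, h, h]
    push_cast
    linear_combination 2 * hs
  · rw [walkCount_odd, walkCount_odd, mul_zero, mul_zero] <;>
      · rw [Int.odd_iff]; push_cast; omega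

section MeanNull

/-- `F` tends to zero in absolute mean along the antidiagonals with respect to the weights `σ`. -/
def MeanNull (σ : ℕ → ℕ → ℝ) (F : ℕ → ℕ → ℝ) : Prop :=
  Tendsto (fun n => ∑ k ∈ Finset.range (n+1), σ n k * |F (n-k) k|) atTop (nhds 0)

variable {σ : ℕ → ℕ → ℝ}

lemma MeanNull.of_abs_le (hσ0 : ∀ n k, k ≤ n → 0 ≤ σ n k)
    {F G : ℕ → ℕ → ℝ} (hG : MeanNull σ G) (h : ∀ m k, |F m k| ≤ |G m k|) :
    MeanNull σ F :=
  squeeze_zero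
    (fun n => Finset.sum_nonneg fun k hk =>
      mul_nonneg (hσ0 n k (Finset.mem_range_succ_iff.1 hk)) (abs_nonneg _))
    (fun n => Finset.sum_le_sum fun k hk =>
      mul_le_mul_of_nonneg_left (h _ _) (hσ0 n k (Finset.mem_range_succ_iff.1 hk))) hG

lemma MeanNull.add (hσ0 : ∀ n k, k ≤ n → 0 ≤ σ n k)
    {F G : ℕ → ℕ → ℝ} (hF : MeanNull σ F) (hG : MeanNull σ G) :
    MeanNull σ (fun m k => F m k + G m k) := by
  have h := Tendsto.add hF hG
  rw [add_zero] at h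
  refine squeeze_zero
    (fun n => Finset.sum_nonneg fun k hk =>
      mul_nonneg (hσ0 n k (Finset.mem_range_succ_iff.1 hk)) (abs_nonneg _)) (fun n => ?_) h
  rw [← Finset.sum_add_distrib]
  refine Finset.sum_le_sum fun k hk => ?_
  rw [← mul_add]
  exact mul_le_mul_of_nonneg_left (abs_add_le _ _) (hσ0 n k (Finset.mem_range_succ_iff.1 hk))

lemma MeanNull.mul_bounded (hσ0 : ∀ n k, k ≤ n → 0 ≤ σ n k)
    {F G : ℕ → ℕ → ℝ} {C : ℝ} (hF : MeanNull σ F)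
    (hG : ∀ m k, |G m k| ≤ C) : MeanNull σ (fun m k => F m k * G m k) := by
  have hC : MeanNull σ (fun m k => C * F m k) := by
    have h := Tendsto.const_mul |C| hF
    rw [mul_zero] at h
    refine h.congr fun n => ?_
    rw [Finset.mul_sum]
    refine Finset.sum_congr rfl fun k _ => ?_
    rw [abs_mul]; ring
  refine hC.of_abs_le hσ0 fun m k => ?_
  rw [abs_mul, abs_mul, mul_comm]
  exact mul_le_mul_of_nonneg_right ((hG m k).trans (le_abs_self C)) (abs_nonneg _)

lemma meanNull_of_sq (hσ0 : ∀ n k, k ≤ n → 0 ≤ σ n k)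
    (hσ1 : ∀ n, ∑ k ∈ Finset.range (n+1), σ n k = 1) {F : ℕ → ℕ → ℝ}
    (h : Tendsto (fun n => ∑ k ∈ Finset.range (n+1), σ n k * F (n-k) k ^ 2) atTop (nhds 0)) :
    MeanNull σ F := by
  have h' := (Real.continuous_sqrt.tendsto 0).comp h
  rw [Real.sqrt_zero] at h'
  refine squeeze_zero
    (fun n => Finset.sum_nonneg fun k hk =>
      mul_nonneg (hσ0 n k (Finset.mem_range_succ_iff.1 hk)) (abs_nonneg _)) (fun n => ?_) h'
  refine Real.le_sqrt_of_sq_le ?_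
  refine (Real.pow_arith_mean_le_arith_mean_pow _ _ _
    (fun k hk => hσ0 n k (Finset.mem_range_succ_iff.1 hk)) (hσ1 n) (fun _ _ => abs_nonneg _)
    2).trans ?_
  simp only [sq_abs, le_refl]

/-- In the mean, the mixed moments of a family of Jacobi matrices with vanishing diagonal and
slowly varying off-diagonal are given by counting walks. -/
lemma meanNull_moment_sub (hσ0 : ∀ n k, k ≤ n → 0 ≤ σ n k)
    {a b : ℕ → ℕ → ℝ} {M : ℕ → ℕ → ℕ → ℕ → ℝ} {A : ℝ} {C : ℕ → ℝ}
    (hM0 : ∀ m i j, M m 0 i j = if i = j then 1 else 0)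
    (hM : ∀ m d l j, M m (d+1) l j =
      b m (l+1) * M m d (l+1) j + a m l * M m d l j + b m l * M m d (l-1) j)
    (hMC : ∀ m d i j, |M m d i j| ≤ C d) (hbA : ∀ m k, |b m k| ≤ A)
    (ha : ∀ i, MeanNull σ (fun m k => a m (k+i)))
    (hb : ∀ i, MeanNull σ (fun m k => b m (k+i) - b m k)) (d i j : ℕ) (hi : d ≤ i) :
    MeanNull σ (fun m k => M m d (k+i) (k+j) - walkCount d ((i:ℤ) - j) * b m k ^ d) := by
  induction d generalizing i with
  | zero =>
    simp only [hM0, walkCount, pow_zero, mul_one, add_right_inj, sub_eq_zero, Nat.cast_inj, sub_self]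
    simp [MeanNull]
  | succ d ih =>
    obtain ⟨i, rfl⟩ := Nat.exists_eq_add_of_le' (show 1 ≤ i by omega)
    have e1 := (hb (i+2)).mul_bounded hσ0 (G := fun m k => M m d (k+(i+2)) (k+j))
      fun m k => hMC m d _ _
    have e2 := (ih (i+2) (by omega)).mul_bounded hσ0 (G := b) hbA
    have e3 := (ha (i+1)).mul_bounded hσ0 (G := fun m k => M m d (k+(i+1)) (k+j))
      fun m k => hMC m d _ _
    have e4 := (hb (i+1)).mul_bounded hσ0 (G := fun m k => M m d (k+i) (k+j))
      fun m k => hMC m d _ _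
    have e5 := (ih i (by omega)).mul_bounded hσ0 (G := b) hbA
    refine ((((e1.add hσ0 e2).add hσ0 e3).add hσ0 e4).add hσ0 e5).of_abs_le hσ0
      fun m k => le_of_eq (congrArg _ ?_)
    rw [hM, walkCount, show (((i+1:ℕ):ℤ) - j + 1) = ((i+2:ℕ):ℤ) - j by push_cast; ring,
      show (((i+1:ℕ):ℤ) - j - 1) = (i:ℤ) - j by push_cast; ring,
      show k + (i+1) - 1 = k + i by omega, show k + (i+1) + 1 = k + (i+2) by omega]
    ring

lemma MeanNull.tendsto (hσ0 : ∀ n k, k ≤ n → 0 ≤ σ n k) {F G : ℕ → ℕ → ℝ} {L : ℝ}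
    (h : MeanNull σ (fun m k => F m k - G m k))
    (hG : Tendsto (fun n => ∑ k ∈ Finset.range (n+1), σ n k * G (n-k) k) atTop (nhds L)) :
    Tendsto (fun n => ∑ k ∈ Finset.range (n+1), σ n k * F (n-k) k) atTop (nhds L) := by
  have h0 : Tendsto (fun n => ∑ k ∈ Finset.range (n+1), σ n k * (F (n-k) k - G (n-k) k))
      atTop (nhds 0) := by
    refine squeeze_zero_norm (fun n => ?_) h
    rw [Real.norm_eq_abs]
    refine (Finset.abs_sum_le_sum_abs _ _).trans (Finset.sum_le_sum fun k hk => ?_)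
    rw [abs_mul, abs_of_nonneg (hσ0 n k (Finset.mem_range_succ_iff.1 hk))]
  have := h0.add hG
  rw [zero_add] at this
  refine this.congr fun n => ?_
  rw [← Finset.sum_add_distrib]
  exact Finset.sum_congr rfl fun k _ => by ring

end MeanNull

section Gegenbauer

lemma intervalIntegrable_one_sub_sq_rpow {r : ℝ} (hr : -1 < r) :
    IntervalIntegrable (fun x : ℝ => (1 - x ^ 2) ^ r) volume (-1) 1 := by
  have h1 : IntervalIntegrable (fun x : ℝ => (1 - x ^ 2) ^ r) volume 0 1 := by
    have h : IntervalIntegrable (fun x : ℝ => (1 - x) ^ r) volume 0 1 := by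
      simpa using ((intervalIntegral.intervalIntegrable_rpow' (a := 0) (b := 1) hr).comp_sub_left
        1).symm
    have h' := h.continuousOn_mul (g := fun x : ℝ => (1 + x) ^ r) <|
      ContinuousOn.rpow_const (by fun_prop) fun x hx => by
        rw [Set.uIcc_of_le zero_le_one] at hx
        exact Or.inl (by linarith [hx.1])
    refine h'.congr fun x hx => ?_
    rw [Set.uIoc_of_le zero_le_one] at hx
    show (1 + x) ^ r * (1 - x) ^ r = _
    rw [← Real.mul_rpow (by linarith [hx.1]) (by linarith [hx.2])]
    congr 1
    ring
  have h2 : IntervalIntegrable (fun x : ℝ => (1 - x ^ 2) ^ r) volume (-1) 0 := by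
    have := (h1.comp_sub_left 0).symm
    simpa using this
  exact h2.trans h1

/-- The unnormalized symmetric Jacobi moment functional. -/
noncomputable def gegenbauerIntegral (r : ℝ) (f : ℝ → ℝ) : ℝ :=
  ∫ x in (-1:ℝ)..1, f x * (1 - x ^ 2) ^ r

lemma intervalIntegrable_mul_rpow {r : ℝ} (hr : -1 < r) {f : ℝ → ℝ} (hf : Continuous f) :
    IntervalIntegrable (fun x : ℝ => f x * (1 - x ^ 2) ^ r) volume (-1) 1 :=
  (intervalIntegrable_one_sub_sq_rpow hr).continuousOn_mul hf.continuousOn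

lemma gegenbauerIntegral_one_pos {r : ℝ} (hr : -1 < r) :
    0 < ∫ x in (-1:ℝ)..1, (1 - x ^ 2) ^ r := by
  refine intervalIntegral.intervalIntegral_pos_of_pos_on (intervalIntegrable_one_sub_sq_rpow hr)
    (fun x hx => Real.rpow_pos_of_pos ?_ r) (by norm_num)
  nlinarith [hx.1, hx.2]

lemma gegenbauerIntegral_sub_le {r : ℝ} (hr : -1 < r) {f g : ℝ → ℝ} (hf : Continuous f)
    (hg : Continuous g) {ε : ℝ} (hfg : ∀ x ∈ Set.Icc (-1:ℝ) 1, |f x - g x| ≤ ε) :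
    |gegenbauerIntegral r f - gegenbauerIntegral r g| ≤
      ε * ∫ x in (-1:ℝ)..1, (1 - x ^ 2) ^ r := by
  unfold gegenbauerIntegral
  rw [← intervalIntegral.integral_sub (intervalIntegrable_mul_rpow hr hf)
    (intervalIntegrable_mul_rpow hr hg), ← Real.norm_eq_abs, ← intervalIntegral.integral_const_mul]
  refine intervalIntegral.norm_integral_le_of_norm_le (by norm_num)
    (ae_of_all _ fun x hx => ?_) ((intervalIntegrable_one_sub_sq_rpow hr).const_mul ε)
  have hx2 : 0 ≤ (1 - x ^ 2) ^ r := Real.rpow_nonneg (by nlinarith [hx.1, hx.2]) r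
  rw [← sub_mul, norm_mul, Real.norm_eq_abs, Real.norm_eq_abs, abs_of_nonneg hx2]
  exact mul_le_mul_of_nonneg_right (hfg x ⟨hx.1.le, hx.2⟩) hx2

lemma gegenbauerIntegral_polynomial {r : ℝ} (hr : -1 < r) (q : Polynomial ℝ) :
    gegenbauerIntegral r (fun x => q.eval x) =
      ∑ i ∈ Finset.range (q.natDegree + 1), q.coeff i * gegenbauerIntegral r (fun x => x ^ i) := by
  unfold gegenbauerIntegral
  simp only [Polynomial.eval_eq_sum_range, Finset.sum_mul, mul_assoc]
  rw [intervalIntegral.integral_finsetSum fun i _ =>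
    (intervalIntegrable_mul_rpow hr (by fun_prop)).const_mul _]
  simp only [intervalIntegral.integral_const_mul]

lemma gegenbauerIntegral_pow_one (r : ℝ) : gegenbauerIntegral r (fun x => x ^ 1) = 0 := by
  have h := intervalIntegral.integral_comp_neg (a := -1) (b := 1)
    (fun x : ℝ => x ^ 1 * (1 - x ^ 2) ^ r)
  simp only [pow_one, neg_neg, neg_mul, even_two, Even.neg_pow, intervalIntegral.integral_neg] at h
  simp only [gegenbauerIntegral, pow_one]
  linarith

lemma gegenbauerIntegral_pow_add_two {r : ℝ} (hr : -1 < r) (d : ℕ) :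
    (d + 3 + 2 * r) * gegenbauerIntegral r (fun x => x ^ (d+2)) =
      (d + 1) * gegenbauerIntegral r (fun x => x ^ d) := by
  have hI : ∀ d : ℕ, IntervalIntegrable (fun x : ℝ => x ^ d * (1 - x ^ 2) ^ r) volume (-1) 1 :=
    fun d => intervalIntegrable_mul_rpow hr (by fun_prop)
  have key := intervalIntegral.integral_eq_sub_of_hasDerivAt_of_le (a := -1) (b := 1)
    (f := fun x : ℝ => x ^ (d+1) * (1 - x ^ 2) ^ (r+1))
    (f' := fun x => (d + 1) * (x ^ d * (1 - x ^ 2) ^ r) -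
      (d + 3 + 2 * r) * (x ^ (d+2) * (1 - x ^ 2) ^ r))
    (by norm_num)
    (ContinuousOn.mul (by fun_prop) (ContinuousOn.rpow_const (by fun_prop) fun x _ =>
      Or.inr (by linarith)))
    (fun x hx => by
      have hx2 : 0 < 1 - x ^ 2 := by nlinarith [hx.1, hx.2]
      have h1 : HasDerivAt (fun x : ℝ => 1 - x ^ 2) (-(2 * x)) x := by
        simpa using (hasDerivAt_pow 2 x).const_sub 1
      have h2 := (hasDerivAt_pow (d+1) x).mul (h1.rpow_const (p := r+1) (Or.inl hx2.ne'))
      refine h2.congr_deriv ?_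
      rw [add_sub_cancel_right, Real.rpow_add_one hx2.ne']
      simp only [Nat.add_sub_cancel]
      push_cast
      ring)
    (((hI d).const_mul _).sub ((hI (d+2)).const_mul _))
  rw [intervalIntegral.integral_sub ((hI d).const_mul _) ((hI (d+2)).const_mul _),
    intervalIntegral.integral_const_mul, intervalIntegral.integral_const_mul] at key
  have hz : (0:ℝ) ^ (r+1) = 0 := Real.zero_rpow (by linarith)
  norm_num [hz] at key
  unfold gegenbauerIntegral
  linarith

end Gegenbauer

section Weights

lemma sum_range_triangle (H : ℕ → ℕ → ℝ) (n : ℕ) :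
    ∑ k ∈ Finset.range (n+1), ∑ l ∈ Finset.range (k+1), H (n-k) l =
      ∑ N ∈ Finset.range (n+1), ∑ l ∈ Finset.range (N+1), H (N-l) l := by
  rw [Finset.sum_sigma', Finset.sum_sigma']
  refine Finset.sum_bij' (fun x _ => ⟨n - x.1 + x.2, x.2⟩) (fun x _ => ⟨n - x.1 + x.2, x.2⟩)
    ?_ ?_ ?_ ?_ ?_
  · rintro ⟨k, l⟩ h; simp only [Finset.mem_sigma, Finset.mem_range] at h ⊢; omega
  · rintro ⟨k, l⟩ h; simp only [Finset.mem_sigma, Finset.mem_range] at h ⊢; omega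
  · rintro ⟨k, l⟩ h
    simp only [Finset.mem_sigma, Finset.mem_range] at h
    simp only [Sigma.mk.injEq, heq_eq_eq, and_true]; omega
  · rintro ⟨k, l⟩ h
    simp only [Finset.mem_sigma, Finset.mem_range] at h
    simp only [Sigma.mk.injEq, heq_eq_eq, and_true]; omega
  · rintro ⟨k, l⟩ h
    simp

/-- Weighted averages of a convergent sequence converge to the same limit. -/
lemma tendsto_weighted_average {u S : ℕ → ℝ} {L : ℝ} (hu : ∀ n, 0 < u n)
    (hU : Tendsto (fun n => ∑ N ∈ Finset.range n, u N) atTop atTop)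
    (hS : Tendsto S atTop (nhds L)) :
    Tendsto (fun n => (∑ N ∈ Finset.range (n+1), u N * S N) / ∑ N ∈ Finset.range (n+1), u N)
      atTop (nhds L) := by
  have h1 : (fun n => u n * (S n - L)) =o[atTop] u := by
    have : (fun n => S n - L) =o[atTop] (fun _ => (1:ℝ)) :=
      (Asymptotics.isLittleO_one_iff ℝ).2 (by simpa using hS.sub_const L)
    simpa using (Asymptotics.isBigO_refl u atTop).mul_isLittleO this
  have h2 := ((h1.sum_range (fun n => (hu n).le) hU).tendsto_div_nhds_zero).comp
    (tendsto_add_atTop_nat 1)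
  have h3 := h2.add_const L
  rw [zero_add] at h3
  refine h3.congr fun n => ?_
  have hpos : 0 < ∑ N ∈ Finset.range (n+1), u N := Finset.sum_pos (fun N _ => hu N) ⟨0, by simp⟩
  simp only [Function.comp, mul_sub, Finset.sum_sub_distrib, ← Finset.sum_mul]
  field_simp
  ring

lemma tendsto_triangle_average {σ W : ℕ → ℕ → ℝ} {v u : ℕ → ℝ} {H : ℕ → ℕ → ℝ} {L : ℝ}
    (hu : ∀ n, 0 < u n) (hU : Tendsto (fun n => ∑ N ∈ Finset.range n, u N) atTop atTop)
    (hσ : ∀ n k, k ≤ n → σ n k = v (n-k) / u n)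
    (hW : ∀ n k, k ≤ n → W n k = v (n-k) / ∑ N ∈ Finset.range (n+1), u N)
    (hS : Tendsto (fun n => ∑ k ∈ Finset.range (n+1), σ n k * H (n-k) k) atTop (nhds L)) :
    Tendsto (fun n => ∑ k ∈ Finset.range (n+1), W n k * ∑ l ∈ Finset.range (k+1), H (n-k) l)
      atTop (nhds L) := by
  refine (tendsto_weighted_average hu hU hS).congr fun n => ?_
  have h1 : ∑ k ∈ Finset.range (n+1), W n k * ∑ l ∈ Finset.range (k+1), H (n-k) l =
      (∑ k ∈ Finset.range (n+1), ∑ l ∈ Finset.range (k+1), v (n-k) * H (n-k) l) /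
        ∑ N ∈ Finset.range (n+1), u N := by
    rw [Finset.sum_div]
    refine Finset.sum_congr rfl fun k hk => ?_
    rw [hW n k (Finset.mem_range_succ_iff.1 hk), ← Finset.mul_sum]
    ring
  rw [h1, sum_range_triangle (fun m l => v m * H m l)]
  congr 1
  refine Finset.sum_congr rfl fun N _ => ?_
  rw [Finset.mul_sum]
  refine Finset.sum_congr rfl fun k hk => ?_
  rw [hσ N k (Finset.mem_range_succ_iff.1 hk)]
  have := (hu N).ne'
  field_simp

/-- The reciprocal normalization of the Cesàro weights of order `α`. -/
noncomputable def cesaroNorm (α : ℝ) (n : ℕ) : ℝ := Real.Gamma (n + α + 1) / Real.Gamma (n + 1)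

lemma cesaroNorm_pos {α : ℝ} (hα : 0 < α) (n : ℕ) : 0 < cesaroNorm α n :=
  div_pos (Real.Gamma_pos_of_pos (by positivity)) (Real.Gamma_pos_of_pos (by positivity))

lemma sum_cesaroNorm {α : ℝ} (hα : 0 < α) (n : ℕ) :
    ∑ N ∈ Finset.range (n+1), cesaroNorm α N =
      Real.Gamma (n + α + 2) / ((α + 1) * Real.Gamma (n + 1)) := by
  induction n with
  | zero =>
    have h : Real.Gamma (α + 1 + 1) = (α + 1) * Real.Gamma (α + 1) :=
      Real.Gamma_add_one (by positivity)
    simp only [cesaroNorm, zero_add, Finset.sum_range_one, Nat.cast_zero,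
      show α + 2 = α + 1 + 1 by ring, h, Real.Gamma_one]
    field_simp
  | succ n ih =>
    have h1 : Real.Gamma ((n:ℝ) + 1 + 1) = (n + 1) * Real.Gamma (n + 1) :=
      Real.Gamma_add_one (by positivity)
    have h2 : Real.Gamma ((n:ℝ) + α + 2 + 1) = (n + α + 2) * Real.Gamma (n + α + 2) :=
      Real.Gamma_add_one (by positivity)
    have h3 : Real.Gamma ((n:ℝ) + 1) ≠ 0 := (Real.Gamma_pos_of_pos (by positivity)).ne'
    rw [Finset.sum_range_succ, ih, cesaroNorm]
    push_cast
    rw [show (n:ℝ) + 1 + α + 1 = n + α + 2 by ring, show (n:ℝ) + 1 + α + 2 = n + α + 2 + 1 by ring,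
      h1, h2]
    field_simp
    ring

lemma cesaroNorm_div_sum {α : ℝ} (hα : 0 < α) (n : ℕ) :
    cesaroNorm α n / ∑ N ∈ Finset.range (n+1), cesaroNorm α N = (α + 1) / (n + α + 1) := by
  have h2 : Real.Gamma ((n:ℝ) + α + 1 + 1) = (n + α + 1) * Real.Gamma (n + α + 1) :=
    Real.Gamma_add_one (by positivity)
  have h3 : Real.Gamma ((n:ℝ) + 1) ≠ 0 := (Real.Gamma_pos_of_pos (by positivity)).ne'
  have h4 : Real.Gamma ((n:ℝ) + α + 1) ≠ 0 := (Real.Gamma_pos_of_pos (by positivity)).ne'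
  rw [sum_cesaroNorm hα, cesaroNorm, show (n:ℝ) + α + 2 = n + α + 1 + 1 by ring, h2]
  field_simp

lemma tendsto_sum_cesaroNorm {α : ℝ} (hα : 0 < α) :
    Tendsto (fun n => ∑ N ∈ Finset.range n, cesaroNorm α N) atTop atTop := by
  have hmono : Monotone (cesaroNorm α) := by
    refine monotone_nat_of_le_succ fun n => ?_
    have h1 : Real.Gamma ((n:ℝ) + 1 + 1) = (n + 1) * Real.Gamma (n + 1) :=
      Real.Gamma_add_one (by positivity)
    have h2 : Real.Gamma ((n:ℝ) + α + 1 + 1) = (n + α + 1) * Real.Gamma (n + α + 1) :=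
      Real.Gamma_add_one (by positivity)
    have h3 : 0 < Real.Gamma ((n:ℝ) + 1) := Real.Gamma_pos_of_pos (by positivity)
    have h4 : 0 < Real.Gamma ((n:ℝ) + α + 1) := Real.Gamma_pos_of_pos (by positivity)
    simp only [cesaroNorm]
    push_cast
    rw [show (n:ℝ) + 1 + α + 1 = n + α + 1 + 1 by ring, h1, h2, div_le_div_iff₀ h3 (by positivity)]
    nlinarith [mul_pos h3 h4]
  refine tendsto_atTop_mono (f := fun n : ℕ => (n:ℝ) * cesaroNorm α 0) (fun n => ?_)
    (tendsto_natCast_atTop_atTop.atTop_mul_const (cesaroNorm_pos hα 0))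
  rw [← nsmul_eq_mul, ← Finset.card_range n, ← Finset.sum_const, Finset.card_range]
  exact Finset.sum_le_sum fun N _ => hmono (Nat.zero_le N)

end Weights

section Limits

lemma gegenbauerIntegral_pow {α : ℝ} (hα : 0 < α) (d : ℕ) :
    gegenbauerIntegral ((α-1)/2) (fun x => x ^ d) =
      (∫ x in (-1:ℝ)..1, (1 - x^2) ^ ((α-1)/2)) * (walkCount d 0 *
        (Real.Gamma (α/2+1) * Real.Gamma ((d:ℝ)/2+1) /
          (2^d * Real.Gamma ((α+(d:ℝ))/2+1)))) := by
  induction d using Nat.twoStepInduction with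
  | zero =>
    have : Real.Gamma (α/2+1) ≠ 0 := (Real.Gamma_pos_of_pos (by positivity)).ne'
    simp [gegenbauerIntegral, walkCount, this]
  | one => rw [gegenbauerIntegral_pow_one, walkCount_odd 1 (by simp)]; simp
  | more d ih _ =>
    have h := gegenbauerIntegral_pow_add_two (r := (α-1)/2) (by linarith) d
    have hw := walkCount_add_two d
    have h1 : Real.Gamma ((d:ℝ)/2+1+1) = ((d:ℝ)/2+1) * Real.Gamma ((d:ℝ)/2+1) :=
      Real.Gamma_add_one (by positivity)
    have h2 : Real.Gamma ((α+(d:ℝ))/2+1+1) = ((α+(d:ℝ))/2+1) * Real.Gamma ((α+(d:ℝ))/2+1) :=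
      Real.Gamma_add_one (by positivity)
    have h3 : Real.Gamma ((α+(d:ℝ))/2+1) ≠ 0 := (Real.Gamma_pos_of_pos (by positivity)).ne'
    rw [ih] at h
    push_cast
    rw [show ((d:ℝ)+2)/2+1 = (d:ℝ)/2+1+1 by ring,
      show (α+((d:ℝ)+2))/2+1 = (α+(d:ℝ))/2+1+1 by ring, h1, h2]
    have hd : ((d:ℝ) + 3 + 2 * ((α-1)/2)) ≠ 0 := by
      have : (0:ℝ) ≤ d := d.cast_nonneg
      intro; linarith
    refine mul_left_cancel₀ hd (h.trans ?_)
    have hαd : α + d + 2 ≠ 0 := by positivity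
    rw [show (d:ℝ) + 3 + 2 * ((α-1)/2) = α + d + 2 by ring,
      show (α+(d:ℝ))/2+1 = (α + d + 2) / 2 by ring] at *
    rw [pow_add]
    field_simp
    linear_combination -(∫ x in (-1:ℝ)..1, (1 - x^2) ^ ((α-1)/2)) * hw

/-- Continuous functionals converging on polynomials converge on all continuous functions. -/
lemma tendsto_of_tendsto_polynomial {Φ : ℕ → (ℝ → ℝ) → ℝ} {I : (ℝ → ℝ) → ℝ} {R K : ℝ}
    (hK : 0 < K)
    (hΦ : ∀ n f g ε, Continuous f → Continuous g → (∀ x ∈ Set.Icc (-R) R, |f x - g x| ≤ ε) →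
      |Φ n f - Φ n g| ≤ K * ε)
    (hI : ∀ f g ε, Continuous f → Continuous g → (∀ x ∈ Set.Icc (-R) R, |f x - g x| ≤ ε) →
      |I f - I g| ≤ K * ε)
    (hpoly : ∀ q : Polynomial ℝ,
      Tendsto (fun n => Φ n (fun x => q.eval x)) atTop (nhds (I fun x => q.eval x)))
    {f : ℝ → ℝ} (hf : Continuous f) : Tendsto (fun n => Φ n f) atTop (nhds (I f)) := by
  rw [Metric.tendsto_atTop]
  intro ε hε
  obtain ⟨q, hq⟩ := exists_polynomial_near_of_continuousOn (-R) R f hf.continuousOn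
    (ε / (3 * K)) (by positivity)
  have hq' : ∀ x ∈ Set.Icc (-R) R, |f x - q.eval x| ≤ ε / (3 * K) := fun x hx => by
    rw [abs_sub_comm]; exact (hq x hx).le
  obtain ⟨N, hN⟩ := Metric.tendsto_atTop.1 (hpoly q) (ε / 3) (by positivity)
  refine ⟨N, fun n hn => ?_⟩
  have h1 := hΦ n f _ _ hf q.continuous hq'
  have h2 := hI f _ _ hf q.continuous hq'
  have h3 := hN n hn
  rw [show K * (ε / (3 * K)) = ε / 3 by field_simp] at h1 h2
  rw [Real.dist_eq] at h3 ⊢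
  rw [abs_le] at h1 h2
  rw [abs_lt] at h3 ⊢
  constructor <;> linarith [h1.1, h1.2, h2.1, h2.2, h3.1, h3.2]

/-- Averages of functionals whose power moments are boundedly close to partial sums of a
double sequence of mean moments converge to the Gegenbauer functional. -/
lemma tendsto_average_functional {α : ℝ} (hα : 0 < α) {R : ℝ} (hR : 1 ≤ R) {W : ℕ → ℕ → ℝ}
    {Λ : ℕ → ℕ → (ℝ → ℝ) → ℝ} {H : ℕ → ℕ → ℕ → ℝ}
    (hW0 : ∀ n k, k ≤ n → 0 ≤ W n k)
    (hW1 : ∀ n : ℕ, ∑ k ∈ Finset.range (n+1), W n k = (α + 1) / (n + α + 1))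
    (hH : ∀ d, Tendsto (fun n => ∑ k ∈ Finset.range (n+1),
      W n k * ∑ l ∈ Finset.range (k+1), H d (n-k) l) atTop
      (nhds (walkCount d 0 * (Real.Gamma (α/2+1) * Real.Gamma ((d:ℝ)/2+1) /
          (2^d * Real.Gamma ((α+(d:ℝ))/2+1))))))
    (hlip : ∀ m k f g ε, Continuous f → Continuous g →
      (∀ x ∈ Set.Icc (-R) R, |f x - g x| ≤ ε) → |Λ m k f - Λ m k g| ≤ (k + 1) * ε)
    (hlin : ∀ m k (q : Polynomial ℝ), Λ m k (fun x => q.eval x) =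
      ∑ i ∈ Finset.range (q.natDegree + 1), q.coeff i * Λ m k (fun x => x ^ i))
    (hcomp : ∀ d, ∃ C, ∀ m k,
      |Λ m k (fun x => x ^ d) - ∑ l ∈ Finset.range (k+1), H d m l| ≤ C)
    {f : ℝ → ℝ} (hf : Continuous f) :
    Tendsto (fun n => ∑ k ∈ Finset.range (n+1), W n k * Λ (n-k) k f) atTop
      (nhds ((1 / (∫ x in (-1:ℝ)..1, (1 - x^2) ^ ((α-1)/2))) *
          ∫ x in (-1:ℝ)..1, f x * (1 - x^2) ^ ((α-1)/2))) := by
  have hr : -1 < (α-1)/2 := by linarith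
  have hm := gegenbauerIntegral_one_pos hr
  set c := ∫ x in (-1:ℝ)..1, (1 - x^2) ^ ((α-1)/2) with hc
  have hWt : Tendsto (fun n => ∑ k ∈ Finset.range (n+1), W n k) atTop (nhds 0) := by
    simp only [hW1, add_assoc]
    exact tendsto_const_nhds.div_atTop
      (tendsto_atTop_add_const_right _ _ tendsto_natCast_atTop_atTop)
  have hpow : ∀ d : ℕ, Tendsto
      (fun n => ∑ k ∈ Finset.range (n+1), W n k * Λ (n-k) k (fun x => x ^ d)) atTop
      (nhds (1 / c * gegenbauerIntegral ((α-1)/2) fun x => x ^ d)) := by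
    intro d
    obtain ⟨C, hC⟩ := hcomp d
    have h0 : Tendsto (fun n => ∑ k ∈ Finset.range (n+1), W n k *
        (Λ (n-k) k (fun x => x ^ d) - ∑ l ∈ Finset.range (k+1), H d (n-k) l))
        atTop (nhds 0) := by
      have hWC := hWt.mul_const C
      rw [zero_mul] at hWC
      refine squeeze_zero_norm (fun n => ?_) hWC
      rw [Real.norm_eq_abs, Finset.sum_mul]
      refine (Finset.abs_sum_le_sum_abs _ _).trans (Finset.sum_le_sum fun k hk => ?_)
      have hw := hW0 n k (Finset.mem_range_succ_iff.1 hk)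
      rw [abs_mul, abs_of_nonneg hw]
      exact mul_le_mul_of_nonneg_left (hC _ _) hw
    have h1 := h0.add (hH d)
    rw [gegenbauerIntegral_pow hα, ← hc, ← mul_assoc, one_div_mul_cancel hm.ne', one_mul]
    rw [zero_add] at h1
    refine h1.congr fun n => ?_
    rw [← Finset.sum_add_distrib]
    exact Finset.sum_congr rfl fun k _ => by ring
  refine tendsto_of_tendsto_polynomial
    (Φ := fun n f => ∑ k ∈ Finset.range (n+1), W n k * Λ (n-k) k f)
    (I := fun f => 1 / c * gegenbauerIntegral ((α-1)/2) f) (R := R) (K := α + 1) (by linarith)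
    ?_ ?_ ?_ hf
  · intro n f g ε hf hg hfg
    have hε : 0 ≤ ε := (abs_nonneg _).trans (hfg 0 ⟨by linarith, by linarith⟩)
    rw [← Finset.sum_sub_distrib]
    refine (Finset.abs_sum_le_sum_abs _ _).trans ?_
    calc _ ≤ ∑ k ∈ Finset.range (n+1), W n k * ((n + 1) * ε) := by
          refine Finset.sum_le_sum fun k hk => ?_
          have hkn := Finset.mem_range_succ_iff.1 hk
          rw [← mul_sub, abs_mul, abs_of_nonneg (hW0 n k hkn)]
          refine mul_le_mul_of_nonneg_left ((hlip _ _ _ _ _ hf hg hfg).trans ?_) (hW0 n k hkn)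
          gcongr
      _ = (α + 1) * ε * ((n + 1) / (n + α + 1)) := by
          rw [← Finset.sum_mul, hW1]; ring
      _ ≤ (α + 1) * ε * 1 := by
          gcongr
          rw [div_le_one (by positivity)]
          linarith
      _ = _ := mul_one _
  · intro f g ε hf hg hfg
    have hfg' : ∀ x ∈ Set.Icc (-1:ℝ) 1, |f x - g x| ≤ ε := fun x hx =>
      hfg x ⟨by linarith [hx.1], by linarith [hx.2]⟩
    have hε : 0 ≤ ε := (abs_nonneg _).trans (hfg' 0 (by simp))
    have h := gegenbauerIntegral_sub_le hr hf hg hfg'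
    rw [← hc] at h
    rw [← mul_sub, abs_mul, abs_of_pos (by positivity)]
    calc _ ≤ 1 / c * (ε * c) := mul_le_mul_of_nonneg_left h (by positivity)
      _ = ε := by field_simp
      _ ≤ (α + 1) * ε := by nlinarith
  · intro q
    have h := tendsto_finsetSum (Finset.range (q.natDegree + 1))
      fun i _ => (hpow i).const_mul (q.coeff i)
    rw [gegenbauerIntegral_polynomial hr]
    convert h using 1
    · funext n
      simp only [hlin, Finset.mul_sum]
      rw [Finset.sum_comm]
      exact Finset.sum_congr rfl fun i _ => Finset.sum_congr rfl fun k _ => by ring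
    · rw [Finset.mul_sum]
      congr 1
      exact Finset.sum_congr rfl fun i _ => by ring

end Limits

theorem stmt17 (α : ℝ) (hα : 0 < α)
    (μ : ℕ → MeasureTheory.Measure ℝ)
    (hfin : ∀ k, MeasureTheory.IsFiniteMeasure (μ k))
    (hsupp : ∃ R : ℝ, ∀ k, μ k ((Set.Icc (-R) R)ᶜ) = 0)
    (p : ℕ → ℕ → Polynomial ℝ) (ca cb : ℕ → ℕ → ℝ)
    (hdeg : ∀ k l, (p k l).natDegree = l)
    (hlead : ∀ k l, 0 < (p k l).leadingCoeff)
    (horth : ∀ k l m, (∫ x, (p k l).eval x * (p k m).eval x ∂ (μ k)) = if l = m then 1 else 0)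
    (hb0 : ∀ k, cb k 0 = 0)
    (hbpos : ∀ k l, 0 < cb k (l+1))
    (hrec : ∀ k l, Polynomial.X * p k l =
      Polynomial.C (cb k (l+1)) * p k (l+1) + Polynomial.C (ca k l) * p k l +
      Polynomial.C (cb k l) * p k (l-1))
    (xr : ℕ → ℕ → ℕ → ℝ)
    (hroot : ∀ k n j, 1 ≤ j → j ≤ n+1 → (p k (n+1)).eval (xr k (n+1) j) = 0)
    (hrootlt : ∀ k n i j, 1 ≤ i → i < j → j ≤ n+1 → xr k (n+1) i < xr k (n+1) j)
    (σ : ℕ → ℕ → ℝ)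
    (hσ0 : ∀ n k, k ≤ n → 0 ≤ σ n k)
    (hσ1 : ∀ n, ∑ k ∈ Finset.range (n+1), σ n k = 1)
    (hσ2 : ∀ k, Filter.Tendsto (fun n => σ n k) Filter.atTop (nhds 0))
    (hσdef : ∀ n k : ℕ, k ≤ n → σ n k =
      α * Real.Gamma ((n:ℝ)-(k:ℝ)+α) * Real.Gamma ((n:ℝ)+1) /
        (Real.Gamma ((n:ℝ)-(k:ℝ)+1) * Real.Gamma ((n:ℝ)+α+1)))
    (hbdA : ∃ A : ℝ, ∀ k n, |ca k n| ≤ A)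
    (hbdB : ∃ B : ℝ, ∀ k n, cb k n ≤ B)
    (hNa : ∀ l : ℕ, 1 ≤ l → Filter.Tendsto
      (fun n => ∑ k ∈ Finset.range (n+1), σ n k * |ca (n-k) (k+l) - ca (n-k) k|)
      Filter.atTop (nhds 0))
    (hNb : ∀ l : ℕ, 1 ≤ l → Filter.Tendsto
      (fun n => ∑ k ∈ Finset.range (n+1), σ n k * |cb (n-k) (k+l) - cb (n-k) k|)
      Filter.atTop (nhds 0))
    (hNs : ∀ la lb : ℕ, Filter.Tendsto
      (fun n => ∑ k ∈ Finset.range (n+1), σ n k * (ca (n-k) k)^la * (cb (n-k) k)^lb)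
      Filter.atTop (nhds (if 1 ≤ la then 0 else Real.Gamma (α/2+1) * Real.Gamma ((lb:ℝ)/2+1) / (2^lb * Real.Gamma ((α+(lb:ℝ))/2+1)))))
    :
    ∀ f : ℝ → ℝ, Continuous f → (∃ C : ℝ, ∀ x, |f x| ≤ C) →
      (Filter.Tendsto (fun n => ∑ k ∈ Finset.range (n+1),
          (Real.Gamma ((n:ℝ)-(k:ℝ)+α) * Real.Gamma (α+2) * Real.Gamma ((n:ℝ)+1) /
            (Real.Gamma α * Real.Gamma ((n:ℝ)-(k:ℝ)+1) * Real.Gamma ((n:ℝ)+α+2))) *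
          ∫ x, f x * (∑ l ∈ Finset.range (k+1), ((p (n-k) l).eval x)^2) ∂ (μ (n-k)))
        Filter.atTop
        (nhds ((1 / (∫ x in (-1:ℝ)..1, (1 - x^2) ^ ((α-1)/2))) *
          ∫ x in (-1:ℝ)..1, f x * (1 - x^2) ^ ((α-1)/2)))) ∧
      (Filter.Tendsto (fun n => ∑ k ∈ Finset.range (n+1),
          (Real.Gamma ((n:ℝ)-(k:ℝ)+α) * Real.Gamma (α+2) * Real.Gamma ((n:ℝ)+1) /
            (Real.Gamma α * Real.Gamma ((n:ℝ)-(k:ℝ)+1) * Real.Gamma ((n:ℝ)+α+2))) *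
          ∑ j ∈ Finset.Icc 1 (k+1), f (xr (n-k) (k+1) j))
        Filter.atTop
        (nhds ((1 / (∫ x in (-1:ℝ)..1, (1 - x^2) ^ ((α-1)/2))) *
          ∫ x in (-1:ℝ)..1, f x * (1 - x^2) ^ ((α-1)/2)))) := by
  intro f hf _
  obtain ⟨R₀, hR₀⟩ := hsupp
  obtain ⟨A, hA⟩ := hbdA
  obtain ⟨B, hB⟩ := hbdB
  have hcb0 : ∀ k l, 0 ≤ cb k l := fun k l => by
    cases l with
    | zero => exact (hb0 k).ge
    | succ l => exact (hbpos k l).le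
  have hB' : ∀ k l, |cb k l| ≤ B := fun k l => by rw [abs_of_nonneg (hcb0 k l)]; exact hB k l
  obtain ⟨R, hR1, hR0R, hABR⟩ : ∃ R : ℝ, 1 ≤ R ∧ R₀ ≤ R ∧ A + 2 * B ≤ R :=
    ⟨max 1 (max R₀ (A + 2 * B)), by simp, by simp, by simp⟩
  have hR0 : 0 ≤ R := by linarith
  have hμ : ∀ k, μ k ((Set.Icc (-R) R)ᶜ) = 0 := fun k =>
    measure_mono_null (Set.compl_subset_compl.2 (Set.Icc_subset_Icc (by linarith) hR0R)) (hR₀ k)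
  have hp0 : ∀ k x, 0 < (p k 0).eval x := fun k x => eval_zero_pos (hdeg k) (hlead k) x
  let v : ℕ → ℝ := fun m => α * Real.Gamma (m + α) / Real.Gamma (m + 1)
  have hσv : ∀ n k, k ≤ n → σ n k = v (n-k) / cesaroNorm α n := fun n k hk => by
    have h1 : Real.Gamma ((n:ℝ) + 1) ≠ 0 := (Real.Gamma_pos_of_pos (by positivity)).ne'
    have h2 : Real.Gamma ((n:ℝ) + α + 1) ≠ 0 := (Real.Gamma_pos_of_pos (by positivity)).ne'
    rw [hσdef n k hk]
    simp only [v, cesaroNorm, Nat.cast_sub hk]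
    field_simp
  have hW : ∀ n k : ℕ, k ≤ n →
      Real.Gamma ((n:ℝ)-(k:ℝ)+α) * Real.Gamma (α+2) * Real.Gamma ((n:ℝ)+1) /
        (Real.Gamma α * Real.Gamma ((n:ℝ)-(k:ℝ)+1) * Real.Gamma ((n:ℝ)+α+2)) =
      v (n-k) / ∑ N ∈ Finset.range (n+1), cesaroNorm α N := fun n k hk => by
    have h1 : Real.Gamma α ≠ 0 := (Real.Gamma_pos_of_pos hα).ne'
    have h2 : Real.Gamma (α+2) = (α+1) * (α * Real.Gamma α) := by
      rw [← Real.Gamma_add_one hα.ne', ← Real.Gamma_add_one (by positivity)]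
      ring_nf
    rw [sum_cesaroNorm hα, h2]
    simp only [v, Nat.cast_sub hk]
    field_simp
  have hWσ : ∀ n k : ℕ, k ≤ n →
      Real.Gamma ((n:ℝ)-(k:ℝ)+α) * Real.Gamma (α+2) * Real.Gamma ((n:ℝ)+1) /
        (Real.Gamma α * Real.Gamma ((n:ℝ)-(k:ℝ)+1) * Real.Gamma ((n:ℝ)+α+2)) =
      σ n k * ((α + 1) / (n + α + 1)) := fun n k hk => by
    rw [hW n k hk, hσv n k hk, ← cesaroNorm_div_sum hα]
    have := (cesaroNorm_pos hα n).ne'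
    field_simp
  set W : ℕ → ℕ → ℝ := fun n k =>
    Real.Gamma ((n:ℝ)-(k:ℝ)+α) * Real.Gamma (α+2) * Real.Gamma ((n:ℝ)+1) /
      (Real.Gamma α * Real.Gamma ((n:ℝ)-(k:ℝ)+1) * Real.Gamma ((n:ℝ)+α+2)) with hWdef
  have hW0 : ∀ n k, k ≤ n → 0 ≤ W n k := fun n k hk => by
    rw [hWdef]
    simp only
    rw [hWσ n k hk]
    exact mul_nonneg (hσ0 n k hk) (by positivity)
  have hW1 : ∀ n : ℕ, ∑ k ∈ Finset.range (n+1), W n k = (α + 1) / (n + α + 1) := fun n => by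
    rw [Finset.sum_congr rfl fun k hk => hWσ n k (Finset.mem_range_succ_iff.1 hk),
      ← Finset.sum_mul, hσ1, one_mul]
  let M : ℕ → ℕ → ℕ → ℕ → ℝ := fun m => mixedMoment (μ m) (p m)
  have hMR : ∀ m d i j, |M m d i j| ≤ R ^ d := fun m d i j =>
    abs_mixedMoment_le (hμ m) (horth m) d i j
  have ha : ∀ i, MeanNull σ (fun m k => ca m (k+i)) := by
    have h0 : MeanNull σ ca := meanNull_of_sq hσ0 hσ1 (by simpa using hNs 2 0)
    intro i
    rcases Nat.eq_zero_or_pos i with rfl | hi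
    · exact h0
    · have h1 : MeanNull σ (fun m k => ca m (k+i) - ca m k) := hNa i hi
      simpa using h1.add hσ0 h0
  have hb : ∀ i, MeanNull σ (fun m k => cb m (k+i) - cb m k) := fun i => by
    rcases Nat.eq_zero_or_pos i with rfl | hi
    · simp [MeanNull]
    · exact hNb i hi
  let H : ℕ → ℕ → ℕ → ℝ := fun d m l => M m d (l+d) (l+d)
  have hH : ∀ d, Tendsto (fun n => ∑ k ∈ Finset.range (n+1),
      W n k * ∑ l ∈ Finset.range (k+1), H d (n-k) l) atTop
      (nhds (walkCount d 0 * (Real.Gamma (α/2+1) * Real.Gamma ((d:ℝ)/2+1) /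
          (2^d * Real.Gamma ((α+(d:ℝ))/2+1))))) := fun d => by
    refine tendsto_triangle_average (cesaroNorm_pos hα) (tendsto_sum_cesaroNorm hα) hσv hW ?_
    have h1 := meanNull_moment_sub (M := M) hσ0
      (fun m i j => by simpa [M, mixedMoment] using horth m i j)
      (fun m d l j => mixedMoment_succ (hμ m) (hrec m) d l j) hMR hB' ha hb d d d le_rfl
    rw [sub_self] at h1
    refine h1.tendsto hσ0 ?_
    have h2 := (hNs 0 d).const_mul (walkCount d 0)
    rw [if_neg (by norm_num)] at h2
    refine h2.congr fun n => ?_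
    rw [Finset.mul_sum]
    exact Finset.sum_congr rfl fun k _ => by ring
  constructor
  · have hint : ∀ m (g : ℝ → ℝ), Continuous g → Integrable g (μ m) := fun m g hg =>
      integrable_of_continuous (hμ m) hg
    have hsum : ∀ m k (g : ℝ → ℝ), Continuous g →
        ∫ x, g x * (∑ l ∈ Finset.range (k+1), ((p m l).eval x)^2) ∂(μ m) =
          ∑ l ∈ Finset.range (k+1), ∫ x, g x * (p m l).eval x ^ 2 ∂(μ m) := fun m k g hg => by
      simp only [Finset.mul_sum]
      exact integral_finsetSum _ fun l _ => hint m _ (by fun_prop)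
    refine tendsto_average_functional hα hR1
      (Λ := fun m k g => ∫ x, g x * (∑ l ∈ Finset.range (k+1), ((p m l).eval x)^2) ∂(μ m))
      hW0 hW1 hH ?_ ?_ ?_ hf
    · intro m k g h ε hg hh hgh
      rw [hsum m k g hg, hsum m k h hh, ← Finset.sum_sub_distrib]
      refine (Finset.abs_sum_le_sum_abs _ _).trans ((Finset.sum_le_sum fun l _ =>
        integral_mul_sq_sub_le (hμ m) (horth m) hg hh hgh l).trans ?_)
      simp
    · intro m k q
      simp only [Polynomial.eval_eq_sum_range (p := q), Finset.sum_mul, mul_assoc]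
      rw [integral_finsetSum _ fun i _ => hint m _ (by fun_prop)]
      simp only [integral_const_mul]
    · intro d
      refine ⟨2 * d * R ^ d, fun m k => ?_⟩
      simp only
      rw [hsum m k _ (by fun_prop)]
      simp only [sq]
      exact abs_sum_sub_sum_shift_le (u := fun l => M m d l l) (fun l => hMR m d l l) d (k+1)
  · have hfin_sum : ∀ m k (g : ℝ → ℝ), ∑ j ∈ Finset.Icc 1 (k+1), g (xr m (k+1) j) =
        ∑ s : Fin (k+1), g (xr m (k+1) (s+1)) := fun m k g => by
      rw [Fin.sum_univ_eq_sum_range (fun s => g (xr m (k+1) (s+1))),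
        show Finset.Icc 1 (k+1) = Finset.Ico 1 (k+1+1) by ext; simp,
        Finset.sum_Ico_eq_sum_range]
      exact Finset.sum_congr rfl fun s _ => by rw [add_comm 1 s]
    have hrt : ∀ m k (s : Fin (k+1)), (p m (k+1)).eval (xr m (k+1) (s+1)) = 0 := fun m k s =>
      hroot m k _ (by omega) (by omega)
    have hle : ∀ m k (s : Fin (k+1)), |xr m (k+1) (s+1)| ≤ R := fun m k s =>
      (abs_root_le (hrec m) (hp0 m _) (hA m) (hB' m) (hrt m k s)).trans hABR
    have hinj : ∀ m k, Function.Injective fun s : Fin (k+1) => xr m (k+1) (s+1) := fun m k =>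
      StrictMono.injective fun s t hst => hrootlt m k _ _ (by omega)
        (Nat.succ_lt_succ hst) (by omega)
    refine tendsto_average_functional hα hR1
      (Λ := fun m k g => ∑ j ∈ Finset.Icc 1 (k+1), g (xr m (k+1) j)) hW0 hW1 hH ?_ ?_ ?_ hf
    · intro m k g h ε _ _ hgh
      simp only [hfin_sum]
      rw [← Finset.sum_sub_distrib]
      refine (Finset.abs_sum_le_sum_abs _ _).trans ((Finset.sum_le_sum fun s _ =>
        hgh _ (abs_le.1 (hle m k s))).trans ?_)
      simp
    · intro m k q
      simp only [Polynomial.eval_eq_sum_range (p := q), Finset.mul_sum]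
      exact Finset.sum_comm
    · intro d
      refine ⟨2 * d * R ^ d + 2 * d * R ^ d, fun m k => ?_⟩
      simp only
      rw [hfin_sum m k (fun x => x ^ d)]
      have h1 := abs_sum_roots_sub_le (hμ m) hR0 (horth m) (hrec m) (hb0 m) (hp0 m) (hinj m k)
        (hrt m k) (hle m k) d
      have h2 := abs_sum_sub_sum_shift_le (u := fun l => M m d l l) (fun l => hMR m d l l) d (k+1)
      exact (abs_sub_le _ _ _).trans (add_le_add h1 h2)
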